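/- For every integer k ≥ 2 and every integer r ≥ 2k·⌈k/2⌉, there exists a 3-edge-coloring of the complete bipartite graph K_{r,r} such that every pair of distinct vertices is connected by at least k internally disjoint rainbow paths (each of length at most 3). -/

import Mathlib

open SimpleGraph

/-- The complete bipartite graph `K_{r,r}` with both parts `Fin r`. -/
abbrev Krr (r : ℕ) : SimpleGraph (Fin r ⊕ Fin r) :=
  completeBipartiteGraph (Fin r) (Fin r)

/-- A walk is a rainbow path (w.r.t. edge-coloring `c`) if it is a path and
all its edges receive pairwise distinct colors. -/
def RainbowPath {V α : Type*} {G : SimpleGraph V} (c : Sym2 V → α) {u v : V}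
    (p : G.Walk u v) : Prop :=
  p.IsPath ∧ (p.edges.map c).Nodup

/-- Two `u`-`v` walks are internally disjoint if they share no vertices other
than `u` and `v`. -/
def IntDisjoint {V : Type*} {G : SimpleGraph V} {u v : V}
    (p q : G.Walk u v) : Prop :=
  ∀ x, x ∈ p.support → x ∈ q.support → x = u ∨ x = v

/-- `G` admits a `j`-edge-coloring under which every two distinct vertices are
joined by at least `k` internally disjoint rainbow paths. -/
def HasRainbowKColoring {V : Type*} (G : SimpleGraph V) (k j : ℕ) : Prop :=
  ∃ c : Sym2 V → Fin j, ∀ u v : V, u ≠ v →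
    ∃ P : Fin k → G.Walk u v, Function.Injective P ∧
      (∀ i, RainbowPath c (P i)) ∧
      ∀ i i', i ≠ i' → IntDisjoint (P i) (P i')

/-- The rainbow `k`-connectivity: the least number of colors as above. -/
noncomputable def rck {V : Type*} (G : SimpleGraph V) (k : ℕ) : ℕ :=
  sInf {j | HasRainbowKColoring G k j}

/-- Good `k`-family of paths between `u` and `v`. -/
def GoodFam {r : ℕ} (k : ℕ) (c : Sym2 (Fin r ⊕ Fin r) → Fin 3) (u v : Fin r ⊕ Fin r) : Prop :=
  ∃ P : Fin k → (Krr r).Walk u v, Function.Injective P ∧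
        (∀ i, RainbowPath c (P i)) ∧
        (∀ i, (P i).length ≤ 3) ∧
        ∀ i i', i ≠ i' → IntDisjoint (P i) (P i')

lemma GoodFam.symm {r k : ℕ} {c : Sym2 (Fin r ⊕ Fin r) → Fin 3} {u v : Fin r ⊕ Fin r}
    (h : GoodFam k c u v) : GoodFam k c v u := by
  obtain ⟨P, h1, h2, h3, h4⟩ := h
  refine ⟨fun i => (P i).reverse, ?_, ?_, ?_, ?_⟩
  · intro i j hij
    apply h1
    have := congrArg Walk.reverse hij
    simpa using this
  · intro i
    refine ⟨(h2 i).1.reverse, ?_⟩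
    rw [Walk.edges_reverse, List.map_reverse, List.nodup_reverse]
    exact (h2 i).2
  · intro i
    simpa using h3 i
  · intro i j hij x hx hy
    simp only [Walk.support_reverse, List.mem_reverse] at hx hy
    exact (h4 i j hij x hx hy).symm

/-- The edge colouring attached to a matrix. -/
def matCol {r : ℕ} (c : Fin r → Fin r → Fin 3) : Sym2 (Fin r ⊕ Fin r) → Fin 3 :=
  Sym2.lift ⟨fun a b => match a, b with
    | Sum.inl i, Sum.inr j => c i j
    | Sum.inr j, Sum.inl i => c i j
    | _, _ => 0, by rintro (a | a) (b | b) <;> rfl⟩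

lemma matCol_lr {r : ℕ} (c : Fin r → Fin r → Fin 3) (i j : Fin r) :
    matCol c s(Sum.inl i, Sum.inr j) = c i j := rfl

lemma matCol_rl {r : ℕ} (c : Fin r → Fin r → Fin 3) (i j : Fin r) :
    matCol c s(Sum.inr j, Sum.inl i) = c i j := rfl

lemma adj_lr {r : ℕ} (i j : Fin r) : (Krr r).Adj (Sum.inl i) (Sum.inr j) := by simp

lemma adj_rl {r : ℕ} (i j : Fin r) : (Krr r).Adj (Sum.inr i) (Sum.inl j) := by simp

lemma good_ll {r k : ℕ} (c : Fin r → Fin r → Fin 3) (i i' : Fin r) (hi : i ≠ i')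
    (f : Fin k → Fin r) (hf : Function.Injective f) (h : ∀ t, c i (f t) ≠ c i' (f t)) :
    GoodFam k (matCol c) (Sum.inl i) (Sum.inl i') := by
  refine ⟨fun t => Walk.cons (adj_lr i (f t)) (Walk.cons (adj_rl (f t) i') Walk.nil),
    ?_, ?_, ?_, ?_⟩
  · intro s t hst
    have := congrArg Walk.support hst
    simp at this
    exact hf this
  · intro t
    refine ⟨?_, ?_⟩
    · simp [Walk.isPath_def, hi]
    · simpa [matCol_lr, matCol_rl] using h t
  · intro t; simp
  · intro s t hst x hx hy
    have := hf.ne hst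
    simp at hx hy
    rcases hx with rfl | rfl | rfl <;> simp_all

lemma good_rr {r k : ℕ} (c : Fin r → Fin r → Fin 3) (i i' : Fin r) (hi : i ≠ i')
    (f : Fin k → Fin r) (hf : Function.Injective f) (h : ∀ t, c (f t) i ≠ c (f t) i') :
    GoodFam k (matCol c) (Sum.inr i) (Sum.inr i') := by
  refine ⟨fun t => Walk.cons (adj_rl i (f t)) (Walk.cons (adj_lr (f t) i') Walk.nil),
    ?_, ?_, ?_, ?_⟩
  · intro s t hst
    have := congrArg Walk.support hst
    simp at this
    exact hf this
  · intro t
    refine ⟨?_, ?_⟩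
    · simp [Walk.isPath_def, hi]
    · simpa [matCol_lr, matCol_rl] using h t
  · intro t; simp
  · intro s t hst x hx hy
    have := hf.ne hst
    simp at hx hy
    rcases hx with rfl | rfl | rfl <;> simp_all

lemma good_lr {r n : ℕ} (c : Fin r → Fin r → Fin 3) (i j : Fin r)
    (w x : Fin n → Fin r) (hw : Function.Injective w) (hx : Function.Injective x)
    (hwj : ∀ t, w t ≠ j) (hxi : ∀ t, x t ≠ i)
    (h1 : ∀ t, c i (w t) ≠ c (x t) (w t)) (h2 : ∀ t, c i (w t) ≠ c (x t) j)
    (h3 : ∀ t, c (x t) (w t) ≠ c (x t) j) :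
    GoodFam (n + 1) (matCol c) (Sum.inl i) (Sum.inr j) := by
  let p0 : (Krr r).Walk (Sum.inl i) (Sum.inr j) := Walk.cons (adj_lr i j) Walk.nil
  let q : Fin n → (Krr r).Walk (Sum.inl i) (Sum.inr j) := fun t =>
    Walk.cons (adj_lr i (w t)) (Walk.cons (adj_rl (w t) (x t))
      (Walk.cons (adj_lr (x t) j) Walk.nil))
  have hp0 : ∀ y, y ∈ p0.support → y = Sum.inl i ∨ y = Sum.inr j := by
    intro y hy; simpa [p0] using hy
  have hq : ∀ t, (q t).support = [Sum.inl i, Sum.inr (w t), Sum.inl (x t), Sum.inr j] := by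
    intro t; simp [q]
  have hql : ∀ t, (q t).length = 3 := by intro t; simp [q]
  have hpl : p0.length = 1 := by simp [p0]
  refine ⟨Fin.cons p0 q, ?_, ?_, ?_, ?_⟩
  · rw [Fin.cons_injective_iff]
    refine ⟨?_, ?_⟩
    · rintro ⟨t, ht⟩
      have := hql t
      rw [ht, hpl] at this
      omega
    · intro s t hst
      have := congrArg Walk.support hst
      rw [hq, hq] at this
      simp at this
      exact hw this.1
  · intro t
    refine Fin.cases ?_ (fun t => ?_) t
    · refine ⟨?_, ?_⟩
      · simp [Walk.isPath_def, p0]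
      · simp [p0]
    · refine ⟨?_, ?_⟩
      · simp only [Fin.cons_succ]
        rw [Walk.isPath_def, hq]
        simp [hwj t, (hxi t).symm]
      · simp [q, matCol_lr, matCol_rl, h1 t, h2 t, h3 t]
  · intro t
    refine Fin.cases ?_ (fun t => ?_) t
    · simp [hpl]
    · simp [hql]
  · intro s t
    refine Fin.cases ?_ (fun s => ?_) s
    · intro _ y hy _
      exact hp0 y hy
    · refine Fin.cases ?_ (fun t => ?_) t
      · intro _ y _ hy
        exact hp0 y hy
      · intro hst y hy hz
        have hst' : s ≠ t := fun h => hst (by rw [h])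
        have a1 := hw.ne hst'
        have a2 := hx.ne hst'
        simp only [Fin.cons_succ, hq] at hy hz
        simp at hy hz
        rcases hy with rfl | rfl | rfl | rfl <;> simp_all

/-- Sufficient condition on the matrix. -/
lemma main_of_mat {r n : ℕ} (c : Fin r → Fin r → Fin 3) (hs : ∀ i j, c i j = c j i)
    (hR : ∀ i i', i ≠ i' → ∃ f : Fin (n + 1) → Fin r, Function.Injective f ∧
      ∀ t, c i (f t) ≠ c i' (f t))
    (hM : ∀ i j, ∃ w x : Fin n → Fin r, Function.Injective w ∧ Function.Injective x ∧
      (∀ t, w t ≠ j) ∧ (∀ t, x t ≠ i) ∧ (∀ t, c i (w t) ≠ c (x t) (w t)) ∧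
      (∀ t, c i (w t) ≠ c (x t) j) ∧ (∀ t, c (x t) (w t) ≠ c (x t) j)) :
    ∃ c : Sym2 (Fin r ⊕ Fin r) → Fin 3, ∀ u v : Fin r ⊕ Fin r, u ≠ v →
      GoodFam (n + 1) c u v := by
  refine ⟨matCol c, ?_⟩
  have key : ∀ i j, GoodFam (n + 1) (matCol c) (Sum.inl i) (Sum.inr j) := by
    intro i j
    obtain ⟨w, x, a1, a2, a3, a4, a5, a6, a7⟩ := hM i j
    exact good_lr c i j w x a1 a2 a3 a4 a5 a6 a7
  rintro (i | i) (j | j) huv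
  · have hij : i ≠ j := fun h => huv (by rw [h])
    obtain ⟨f, hf, h⟩ := hR i j hij
    exact good_ll c i j hij f hf h
  · exact key i j
  · exact (key j i).symm
  · have hij : i ≠ j := fun h => huv (by rw [h])
    obtain ⟨f, hf, h⟩ := hR i j hij
    exact good_rr c i j hij f hf (fun t => by rw [hs (f t) i, hs (f t) j]; exact h t)

/-- The case `k = 2` from a small check. -/
lemma main_two {r : ℕ} (c : Fin r → Fin r → Fin 3) (hs : ∀ i j, c i j = c j i)
    (hR : ∀ i i', i ≠ i' → ∃ p q, p ≠ q ∧ c i p ≠ c i' p ∧ c i q ≠ c i' q)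
    (hM : ∀ i j, ∃ w x, w ≠ j ∧ x ≠ i ∧ c i w ≠ c x w ∧ c i w ≠ c x j ∧ c x w ≠ c x j) :
    ∃ c : Sym2 (Fin r ⊕ Fin r) → Fin 3, ∀ u v : Fin r ⊕ Fin r, u ≠ v →
      GoodFam 2 c u v := by
  refine main_of_mat (n := 1) c hs ?_ ?_
  · intro i i' h
    obtain ⟨p, q, hpq, h1, h2⟩ := hR i i' h
    refine ⟨![p, q], ?_, ?_⟩
    · intro a b hab
      fin_cases a <;> fin_cases b <;> simp_all
    · intro t
      fin_cases t <;> simp_all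
  · intro i j
    obtain ⟨w, x, h1, h2, h3, h4, h5⟩ := hM i j
    exact ⟨fun _ => w, fun _ => x, Function.injective_of_subsingleton _,
      Function.injective_of_subsingleton _, fun _ => h1, fun _ => h2, fun _ => h3,
      fun _ => h4, fun _ => h5⟩

lemma main_four : ∃ c : Sym2 (Fin 4 ⊕ Fin 4) → Fin 3, ∀ u v : Fin 4 ⊕ Fin 4, u ≠ v →
      GoodFam 2 c u v :=
  main_two (fun i j => (![![2, 1, 1, 2], ![1, 0, 2, 0], ![1, 2, 0, 0], ![2, 0, 0, 2]] :
    Fin 4 → Fin 4 → Fin 3) i j) (by decide) (by decide) (by decide)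

lemma main_five : ∃ c : Sym2 (Fin 5 ⊕ Fin 5) → Fin 3, ∀ u v : Fin 5 ⊕ Fin 5, u ≠ v →
      GoodFam 2 c u v :=
  main_two (fun i j => (![![2, 2, 1, 2, 2], ![2, 0, 2, 0, 2], ![1, 2, 0, 0, 1],
    ![2, 0, 0, 0, 1], ![2, 2, 1, 1, 0]] :
    Fin 5 → Fin 5 → Fin 3) i j) (by decide) (by decide) (by decide)

/-- The colour matrix: vertex `i` is the pair (group `i % G`, position `i / G`). -/
def gcol (G S i j : ℕ) : Fin 3 :=
  if i % G = j % G ∧ ¬ (i / G = j / G ∧ S ≤ i / G) then 0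
  else if i / G = j / G then 1 else 2

/-- Enumerates the naturals other than `b`. -/
def skp (b t : ℕ) : ℕ := if t < b then t else t + 1

lemma skp_ne (b t : ℕ) : skp b t ≠ b := by unfold skp; split_ifs <;> omega

lemma skp_inj (b s t : ℕ) (h : skp b s = skp b t) : s = t := by
  unfold skp at h; split_ifs at h <;> omega

lemma skp_le (b t : ℕ) : skp b t ≤ t + 1 := by unfold skp; split_ifs <;> omega

lemma gcol_symm (G S i j : ℕ) : gcol G S i j = gcol G S j i := by
  unfold gcol; grind

lemma gcol_zero {G S i j : ℕ} (h : i % G = j % G) (h' : i / G < S) : gcol G S i j = 0 := by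
  unfold gcol
  rw [if_pos ⟨h, by omega⟩]

lemma gcol_zero2 {G S i j : ℕ} (h : i % G = j % G) (h' : i / G ≠ j / G) : gcol G S i j = 0 := by
  unfold gcol
  rw [if_pos ⟨h, by omega⟩]

lemma gcol_one {G S i j : ℕ} (h : i % G ≠ j % G) (h' : i / G = j / G) : gcol G S i j = 1 := by
  unfold gcol
  rw [if_neg (by omega), if_pos h']

lemma gcol_one2 {G S i j : ℕ} (h : S ≤ i / G) (h' : i / G = j / G) : gcol G S i j = 1 := by
  unfold gcol
  rw [if_neg (by omega), if_pos h']

lemma gcol_two {G S i j : ℕ} (h : i % G ≠ j % G) (h' : i / G ≠ j / G) : gcol G S i j = 2 := by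
  unfold gcol
  rw [if_neg (by omega), if_neg h']

lemma gcol_ne_zero {G S i j : ℕ} (h : i % G ≠ j % G) : gcol G S i j ≠ 0 := by
  by_cases h' : i / G = j / G
  · rw [gcol_one h h']; decide
  · rw [gcol_two h h']; decide

lemma main_big (r n G : ℕ) (hn : 1 ≤ n) (hG : n + 1 ≤ G) (hG3 : 3 ≤ G) (hS : n + 1 ≤ r / G) :
    ∃ c : Sym2 (Fin r ⊕ Fin r) → Fin 3, ∀ u v : Fin r ⊕ Fin r, u ≠ v →
      GoodFam (n + 1) c u v := by
  obtain ⟨S, hSdef⟩ : ∃ S, S = r / G := ⟨_, rfl⟩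
  rw [← hSdef] at hS
  have hGS : G * S ≤ r := by rw [hSdef]; exact Nat.mul_div_le r G
  have hle : ∀ i : Fin r, (i : ℕ) / G ≤ S := by
    intro i; rw [hSdef]; exact Nat.div_le_div_right i.2.le
  have hex : ∀ a y, ∃ z : Fin r, a < G → y < S → (z : ℕ) % G = a ∧ (z : ℕ) / G = y := by
    intro a y
    by_cases h : a < G ∧ y < S
    · obtain ⟨ha, hy⟩ := h
      have h1 : G * (y + 1) ≤ G * S := Nat.mul_le_mul_left G hy
      refine ⟨⟨a + G * y, by rw [Nat.mul_add] at h1; omega⟩, fun _ _ => ⟨?_, ?_⟩⟩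
      · simp [Nat.mod_eq_of_lt ha]
      · simp only
        rw [Nat.add_mul_div_left _ _ (by omega), Nat.div_eq_of_lt ha]; omega
    · have hr : 0 < r := by
        have : 1 * 1 ≤ G * S := Nat.mul_le_mul (by omega) (by omega)
        omega
      exact ⟨⟨0, hr⟩, fun h1 h2 => absurd ⟨h1, h2⟩ h⟩
  choose g hg using hex
  have hmod : ∀ i : ℕ, i % G < G := fun i => Nat.mod_lt _ (by omega)
  have hext : ∀ i j : Fin r, (i : ℕ) % G = (j : ℕ) % G → (i : ℕ) / G = (j : ℕ) / G → i = j := by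
    intro i j h1 h2
    apply Fin.ext
    rw [← Nat.div_add_mod (i : ℕ) G, ← Nat.div_add_mod (j : ℕ) G, h1, h2]
  -- same group
  have same : ∀ i i' : Fin r, (i : ℕ) % G = (i' : ℕ) % G → (i : ℕ) / G < (i' : ℕ) / G →
      ∃ f : Fin (n + 1) → Fin r, Function.Injective f ∧
      ∀ t, gcol G S i (f t) ≠ gcol G S i' (f t) := by
    intro i i' hm hd
    have hiS : (i : ℕ) / G < S := lt_of_lt_of_le hd (hle i')
    obtain ⟨e, he, hec⟩ : ∃ e : Fin r, (e : ℕ) / G = (i' : ℕ) / G ∧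
        gcol G S i e ≠ gcol G S i' e := by
      by_cases hi' : (i' : ℕ) / G < S
      · have hsk := skp_le ((i : ℕ) % G) 0
        have hne := skp_ne ((i : ℕ) % G) 0
        obtain ⟨e1, e2⟩ := hg (skp ((i : ℕ) % G) 0) ((i' : ℕ) / G) (by omega) hi'
        refine ⟨_, e2, ?_⟩
        rw [gcol_two (by omega) (by omega), gcol_one (by omega) (by omega)]
        decide
      · refine ⟨i', rfl, ?_⟩
        rw [gcol_zero hm hiS, gcol_one2 (by omega) rfl]
        decide
    have hgs : ∀ t : Fin n, _ := fun t => hg (skp ((i : ℕ) % G) t) ((i : ℕ) / G)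
      (by have := skp_le ((i : ℕ) % G) t; omega) hiS
    refine ⟨Fin.cons e (fun t : Fin n => g (skp ((i : ℕ) % G) t) ((i : ℕ) / G)), ?_, ?_⟩
    · rw [Fin.cons_injective_iff]
      refine ⟨?_, ?_⟩
      · rintro ⟨t, ht⟩
        have := (hgs t).2
        simp only at ht
        rw [ht] at this
        omega
      · intro s t hst
        simp only at hst
        have h1 := (hgs s).1
        rw [hst, (hgs t).1] at h1
        exact Fin.ext (skp_inj _ _ _ h1).symm
    · intro t
      refine Fin.cases ?_ (fun t => ?_) t
      · simpa using hec
      · simp only [Fin.cons_succ]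
        obtain ⟨e1, e2⟩ := hgs t
        have hne := skp_ne ((i : ℕ) % G) t
        rw [gcol_one (by omega) (by omega), gcol_two (by omega) (by omega)]
        decide
  refine main_of_mat (n := n) (fun i j : Fin r => gcol G S i j) (fun i j => gcol_symm _ _ _ _) ?_ ?_
  · intro i i' hne
    by_cases hm : (i : ℕ) % G = (i' : ℕ) % G
    · have hd : (i : ℕ) / G ≠ (i' : ℕ) / G := fun h => hne (hext _ _ hm h)
      rcases lt_or_gt_of_ne hd with h | h
      · exact same i i' hm h
      · obtain ⟨f, hf, h⟩ := same i' i hm.symm h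
        exact ⟨f, hf, fun t => (h t).symm⟩
    · have hgs : ∀ t : Fin (n + 1), _ := fun t => hg ((i : ℕ) % G) t (hmod i) (by omega)
      refine ⟨fun t => g ((i : ℕ) % G) t, ?_, ?_⟩
      · intro s t hst
        simp only at hst
        have h1 := (hgs s).2
        rw [hst, (hgs t).2] at h1
        exact Fin.ext h1.symm
      · intro t
        obtain ⟨e1, e2⟩ := hgs t
        simp only
        rw [gcol_symm G S i, gcol_zero e1 (by omega)]
        exact (gcol_ne_zero (by omega)).symm
  · intro i j
    by_cases hm : (i : ℕ) % G = (j : ℕ) % G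
    · -- same group
      have hw : ∀ t : Fin n, _ := fun t =>
        hg (skp ((i : ℕ) % G) t) (skp ((i : ℕ) / G) t)
          (by have := skp_le ((i : ℕ) % G) t; omega)
          (by have := skp_le ((i : ℕ) / G) t; omega)
      have hx : ∀ t : Fin n, _ := fun t =>
        hg ((i : ℕ) % G) (skp ((i : ℕ) / G) t) (hmod i)
          (by have := skp_le ((i : ℕ) / G) t; omega)
      have c1 : ∀ t : Fin n, gcol G S i
          (g (skp ((i : ℕ) % G) t) (skp ((i : ℕ) / G) t)) = 2 := by
        intro t
        have := hw t
        have h1 := skp_ne ((i : ℕ) % G) t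
        have h2 := skp_ne ((i : ℕ) / G) t
        exact gcol_two (by omega) (by omega)
      have c2 : ∀ t : Fin n, gcol G S (g ((i : ℕ) % G) (skp ((i : ℕ) / G) t))
          (g (skp ((i : ℕ) % G) t) (skp ((i : ℕ) / G) t)) = 1 := by
        intro t
        have := hw t
        have := hx t
        have h1 := skp_ne ((i : ℕ) % G) t
        exact gcol_one (by omega) (by omega)
      have c3 : ∀ t : Fin n, gcol G S (g ((i : ℕ) % G) (skp ((i : ℕ) / G) t)) j = 0 := by
        intro t
        have := hx t
        have := skp_le ((i : ℕ) / G) t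
        exact gcol_zero (by omega) (by omega)
      refine ⟨fun t => g (skp ((i : ℕ) % G) t) (skp ((i : ℕ) / G) t),
        fun t => g ((i : ℕ) % G) (skp ((i : ℕ) / G) t), ?_, ?_, ?_, ?_, ?_, ?_, ?_⟩
      · intro s t hst
        simp only at hst
        have h1 := (hw s).1
        rw [hst, (hw t).1] at h1
        exact Fin.ext (skp_inj _ _ _ h1).symm
      · intro s t hst
        simp only at hst
        have h1 := (hx s).2
        rw [hst, (hx t).2] at h1
        exact Fin.ext (skp_inj _ _ _ h1).symm
      · intro t ht
        have h1 := (hw t).1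
        simp only at ht
        rw [ht, ← hm] at h1
        exact skp_ne _ _ h1.symm
      · intro t ht
        have h1 := (hx t).2
        simp only at ht
        rw [ht] at h1
        exact skp_ne _ _ h1.symm
      · intro t; simp only [c1, c2]; decide
      · intro t; simp only [c1, c3]; decide
      · intro t; simp only [c2, c3]; decide
    · -- different groups
      obtain ⟨d, hdG, hdi, hdj⟩ : ∃ d, d < G ∧ d ≠ (i : ℕ) % G ∧ d ≠ (j : ℕ) % G := by
        by_cases h0 : 0 ≠ (i : ℕ) % G ∧ 0 ≠ (j : ℕ) % G
        · exact ⟨0, by omega, h0.1, h0.2⟩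
        · by_cases h1 : 1 ≠ (i : ℕ) % G ∧ 1 ≠ (j : ℕ) % G
          · exact ⟨1, by omega, h1.1, h1.2⟩
          · exact ⟨2, by omega, by omega, by omega⟩
      have hw : ∀ t : Fin n, _ := fun t =>
        hg ((i : ℕ) % G) (skp ((j : ℕ) / G) t) (hmod i)
          (by have := skp_le ((j : ℕ) / G) t; omega)
      have hx : ∀ t : Fin n, _ := fun t =>
        hg d (skp ((j : ℕ) / G) t) hdG
          (by have := skp_le ((j : ℕ) / G) t; omega)
      have c1 : ∀ t : Fin n, gcol G S i (g ((i : ℕ) % G) (skp ((j : ℕ) / G) t)) = 0 := by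
        intro t
        have := hw t
        have := skp_le ((j : ℕ) / G) t
        rw [gcol_symm]
        exact gcol_zero (by omega) (by omega)
      have c2 : ∀ t : Fin n, gcol G S (g d (skp ((j : ℕ) / G) t))
          (g ((i : ℕ) % G) (skp ((j : ℕ) / G) t)) = 1 := by
        intro t
        have := hw t
        have := hx t
        exact gcol_one (by omega) (by omega)
      have c3 : ∀ t : Fin n, gcol G S (g d (skp ((j : ℕ) / G) t)) j = 2 := by
        intro t
        have := hx t
        have := skp_ne ((j : ℕ) / G) t
        exact gcol_two (by omega) (by omega)
      refine ⟨fun t => g ((i : ℕ) % G) (skp ((j : ℕ) / G) t),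
        fun t => g d (skp ((j : ℕ) / G) t), ?_, ?_, ?_, ?_, ?_, ?_, ?_⟩
      · intro s t hst
        simp only at hst
        have h1 := (hw s).2
        rw [hst, (hw t).2] at h1
        exact Fin.ext (skp_inj _ _ _ h1).symm
      · intro s t hst
        simp only at hst
        have h1 := (hx s).2
        rw [hst, (hx t).2] at h1
        exact Fin.ext (skp_inj _ _ _ h1).symm
      · intro t ht
        have h1 := (hw t).1
        simp only at ht
        rw [ht] at h1
        exact hm h1.symm
      · intro t ht
        have h1 := (hx t).1
        simp only at ht
        rw [ht] at h1
        exact hdi h1.symm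
      · intro t; simp only [c1, c2]; decide
      · intro t; simp only [c1, c3]; decide
      · intro t; simp only [c2, c3]; decide

theorem stmt6 (k r : ℕ) (hk : 2 ≤ k) (hr : 2 * k * ((k + 1) / 2) ≤ r) :
    ∃ c : Sym2 (Fin r ⊕ Fin r) → Fin 3, ∀ u v : Fin r ⊕ Fin r, u ≠ v →
      ∃ P : Fin k → (Krr r).Walk u v, Function.Injective P ∧
        (∀ i, RainbowPath c (P i)) ∧
        (∀ i, (P i).length ≤ 3) ∧
        ∀ i i', i ≠ i' → IntDisjoint (P i) (P i') := by
  change ∃ c : Sym2 (Fin r ⊕ Fin r) → Fin 3, ∀ u v : Fin r ⊕ Fin r, u ≠ v → GoodFam k c u v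
  obtain ⟨n, rfl⟩ : ∃ n, k = n + 1 := ⟨k - 1, by omega⟩
  by_cases h3 : 3 ≤ n + 1
  · refine main_big r n (n + 1) (by omega) le_rfl h3 ?_
    rw [Nat.le_div_iff_mul_le (by omega)]
    have h1 : n + 1 ≤ 2 * ((n + 1 + 1) / 2) := by omega
    calc (n + 1) * (n + 1) ≤ (n + 1) * (2 * ((n + 1 + 1) / 2)) := Nat.mul_le_mul_left _ h1
      _ = 2 * (n + 1) * ((n + 1 + 1) / 2) := by ring
      _ ≤ r := hr
  · obtain rfl : n = 1 := by omega
    norm_num at hr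
    by_cases h6 : 6 ≤ r
    · exact main_big r 1 3 le_rfl (by omega) le_rfl (by omega)
    · obtain rfl | rfl : r = 4 ∨ r = 5 := by omega
      · exact main_four
      · exact main_five
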